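/- arXiv:1610.09057 — 2 statements merged into one kernel-verified Lean document; each statement's English description precedes it below -/
import Mathlib

section
/- Let (X_n, Y_n) be a sequence of pairs of random variables such that: (a) each X_n takes values in the nonnegative integers almost surely; (b) conditionally on X_n, the variable Y_n has the binomial distribution with parameters (X_n, 1/2); (c) (X_n − a_n)/√a_n converges in distribution to a standard Gaussian, for some sequence a_n → ∞. Then (Y_n − a_n/2)/√(a_n/2) converges in distribution to a standard Gaussian. -/
open MeasureTheory Filter Topology ProbabilityTheory

theorem nullMeasurableSet_of_measure_add_compl_le {α : Type*} [MeasurableSpace α] {μ : Measure α}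
    [IsFiniteMeasure μ] {s : Set α} (h : μ s + μ sᶜ ≤ μ Set.univ) : NullMeasurableSet s μ := by
  have hunion : toMeasurable μ s ∪ toMeasurable μ sᶜ = Set.univ :=
    Set.eq_univ_of_univ_subset <| by
      rw [← Set.union_compl_self s]
      exact Set.union_subset_union (subset_toMeasurable μ s) (subset_toMeasurable μ sᶜ)
  have hinter : μ (toMeasurable μ s ∩ toMeasurable μ sᶜ) = 0 := by
    have key := measure_union_add_inter (μ := μ) (toMeasurable μ s)
      (measurableSet_toMeasurable μ sᶜ)
    rw [hunion, measure_toMeasurable, measure_toMeasurable] at key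
    rw [← key] at h
    simpa using ENNReal.le_of_add_le_add_left (measure_ne_top μ _)
      (h.trans_eq (add_zero (μ Set.univ)).symm)
  refine (measurableSet_toMeasurable μ s).nullMeasurableSet.congr ?_
  refine EventuallyLE.antisymm (ae_le_set.2 (measure_mono_null ?_ hinter))
    (LE.le.eventuallyLE (subset_toMeasurable μ s))
  exact fun x hx => ⟨hx.1, subset_toMeasurable μ sᶜ hx.2⟩

theorem aemeasurable_of_tsum_measure_fiber_le {α ι : Type*} [MeasurableSpace α] {μ : Measure α}
    [IsFiniteMeasure μ] [Countable ι] [MeasurableSpace ι] [MeasurableSingletonClass ι] {f : α → ι}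
    (h : ∑' i, μ (f ⁻¹' {i}) ≤ μ Set.univ) : AEMeasurable f μ := by
  classical
  have hfiber (i : ι) : NullMeasurableSet (f ⁻¹' {i}) μ := by
    refine nullMeasurableSet_of_measure_add_compl_le (le_trans ?_ h)
    rw [ENNReal.tsum_eq_add_tsum_ite i]
    gcongr
    calc μ (f ⁻¹' {i})ᶜ ≤ μ (⋃ j, if j = i then ∅ else f ⁻¹' {j}) := by
          refine measure_mono fun x hx => Set.mem_iUnion.2 ⟨f x, ?_⟩
          have : f x ≠ i := hx
          simp [this]
      _ ≤ ∑' j, μ (if j = i then ∅ else f ⁻¹' {j}) := measure_iUnion_le _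
      _ = ∑' j, if j = i then 0 else μ (f ⁻¹' {j}) := by
          congr 1; ext j; split_ifs <;> simp
  refine NullMeasurable.aemeasurable fun s _ => ?_
  rw [← Set.biUnion_of_singleton s, Set.preimage_iUnion₂]
  exact NullMeasurableSet.biUnion s.to_countable fun i _ => hfiber i

theorem tsum_ofReal_choose_mul_half_pow (k : ℕ) :
    ∑' m : ℕ, ENNReal.ofReal ((k.choose m : ℝ) * (1 / 2) ^ k) = 1 := by
  rw [tsum_eq_sum (s := Finset.range (k + 1)), ← ENNReal.ofReal_sum_of_nonneg,
    ← Finset.sum_mul, ← Nat.cast_sum, Nat.sum_range_choose]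
  · simp
  · intros; positivity
  · intro m hm
    rw [Nat.choose_eq_zero_of_lt (by simpa using hm)]
    simp

section Binomial

variable {Ω : Type*} [MeasurableSpace Ω] {P : Measure Ω} [IsProbabilityMeasure P] {K N : Ω → ℕ}

theorem aemeasurable_prodMk_of_binomial (hK : AEMeasurable K P)
    (hbin : ∀ k m : ℕ, P {ω | K ω = k ∧ N ω = m}
      = P {ω | K ω = k} * ENNReal.ofReal ((k.choose m : ℝ) * (1 / 2) ^ k)) :
    AEMeasurable (fun ω => (K ω, N ω)) P := by
  refine aemeasurable_of_tsum_measure_fiber_le ?_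
  have hfiber (p : ℕ × ℕ) : P ((fun ω => (K ω, N ω)) ⁻¹' {p})
      = P (K ⁻¹' {p.1}) * ENNReal.ofReal ((p.1.choose p.2 : ℝ) * (1 / 2) ^ p.1) := by
    rw [← show {ω | K ω = p.1} = K ⁻¹' {p.1} from rfl, ← hbin]
    congr 1; ext ω; simp [Prod.ext_iff]
  simp_rw [hfiber]
  rw [ENNReal.tsum_prod']
  simp_rw [ENNReal.tsum_mul_left, tsum_ofReal_choose_mul_half_pow, mul_one]
  calc ∑' k, P (K ⁻¹' {k}) = ∑' k, P.map K {k} := by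
        congr 1; ext k
        rw [Measure.map_apply_of_aemeasurable hK (measurableSet_singleton k)]
    _ = P.map K Set.univ := by
        rw [← lintegral_one, lintegral_countable']; simp
    _ ≤ P Set.univ := by
        rw [Measure.map_apply_of_aemeasurable hK MeasurableSet.univ]; simp

theorem integral_pow_of_binomial (hK : AEMeasurable K P)
    (hbin : ∀ k m : ℕ, P {ω | K ω = k ∧ N ω = m}
      = P {ω | K ω = k} * ENNReal.ofReal ((k.choose m : ℝ) * (1 / 2) ^ k))
    {z : ℂ} (hz : ‖z‖ ≤ 1) :
    ∫ ω, z ^ N ω ∂P = ∫ ω, ((1 + z) / 2) ^ K ω ∂P := by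
  have hpair := aemeasurable_prodMk_of_binomial hK hbin
  have : IsProbabilityMeasure (P.map fun ω => (K ω, N ω)) := Measure.isProbabilityMeasure_map hpair
  have : IsProbabilityMeasure (P.map K) := Measure.isProbabilityMeasure_map hK
  have hz' : ‖(1 + z) / 2‖ ≤ 1 := by
    rw [norm_div, div_le_one (by simp)]
    calc ‖1 + z‖ ≤ ‖(1 : ℂ)‖ + ‖z‖ := norm_add_le _ _
      _ ≤ ‖(2 : ℂ)‖ := by norm_num; linarith
  have hint1 : Integrable (fun p : ℕ × ℕ => z ^ p.2) (P.map fun ω => (K ω, N ω)) :=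
    .of_bound (by fun_prop) 1 (.of_forall fun p => by
      rw [norm_pow]; exact pow_le_one₀ (norm_nonneg _) hz)
  have hint2 : Integrable (fun k : ℕ => ((1 + z) / 2) ^ k) (P.map K) :=
    .of_bound (by fun_prop) 1 (.of_forall fun p => by
      rw [norm_pow]; exact pow_le_one₀ (norm_nonneg _) hz')
  have hlaw (k m : ℕ) : (P.map fun ω => (K ω, N ω)).real {(k, m)}
      = (P.map K).real {k} * ((k.choose m : ℝ) * (1 / 2) ^ k) := by
    rw [measureReal_def, measureReal_def, Measure.map_apply_of_aemeasurable hpair (by simp),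
      Measure.map_apply_of_aemeasurable hK (by simp),
      show (fun ω => (K ω, N ω)) ⁻¹' {(k, m)} = {ω | K ω = k ∧ N ω = m} by ext ω; simp,
      hbin, ENNReal.toReal_mul, ENNReal.toReal_ofReal (by positivity)]
    rfl
  rw [← integral_map (φ := fun ω => (K ω, N ω)) (f := fun p : ℕ × ℕ => z ^ p.2) hpair
      (by fun_prop),
    ← integral_map (φ := K) (f := fun k : ℕ => ((1 + z) / 2) ^ k) hK (by fun_prop),
    integral_countable hint1, integral_countable hint2]
  have hsum : Summable fun p : ℕ × ℕ =>
      (P.map fun ω => (K ω, N ω)).real {p} • z ^ p.2 := by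
    rw [← Measure.sum_smul_dirac (P.map fun ω => (K ω, N ω))] at hint1
    refine (hasSum_integral_measure hint1).summable.congr fun p => ?_
    rw [integral_smul_measure, integral_dirac, measureReal_def]
  rw [hsum.tsum_prod]
  refine tsum_congr fun k => ?_
  rw [tsum_eq_sum (s := Finset.range (k + 1))]
  · simp_rw [hlaw, mul_smul, ← Finset.smul_sum]
    congr 1
    rw [add_comm 1 z, div_pow (z + 1), add_pow, Finset.sum_div]
    refine Finset.sum_congr rfl fun m _ => ?_
    simp only [Complex.real_smul]
    push_cast
    rw [one_div, inv_pow, one_pow]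
    field_simp
  · intro m hm
    rw [hlaw, Nat.choose_eq_zero_of_lt (by simpa using hm)]
    simp

end Binomial

theorem abs_exp_neg_sub_exp_neg_le {u v : ℝ} (hu : 0 ≤ u) (hv : 0 ≤ v) :
    |Real.exp (-u) - Real.exp (-v)| ≤ min 1 |u - v| := by
  wlog h : u ≤ v generalizing u v
  · rw [abs_sub_comm, abs_sub_comm u]; exact this hv hu (le_of_not_ge h)
  have hle : Real.exp (-v) ≤ Real.exp (-u) := Real.exp_le_exp.2 (by linarith)
  have hu1 : Real.exp (-u) ≤ 1 := Real.exp_le_one_iff.2 (by linarith)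
  rw [abs_of_nonneg (by linarith), abs_sub_comm, abs_of_nonneg (sub_nonneg.2 h)]
  refine le_min (by linarith [Real.exp_pos (-v)]) ?_
  have hmul : Real.exp (-v) = Real.exp (-u) * Real.exp (u - v) := by
    rw [← Real.exp_add]; congr 1; ring
  nlinarith [Real.add_one_le_exp (u - v), Real.exp_pos (-u)]

theorem tendsto_mul_log_cos_div_sqrt (t : ℝ) :
    Tendsto (fun x : ℝ => x * Real.log (Real.cos (t / √(2 * x)))) atTop (𝓝 (-(t ^ 2 / 4))) := by
  have hcos : Tendsto (fun x : ℝ => x * (Real.cos (t / √(2 * x)) - 1)) atTop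
      (𝓝 (-(t ^ 2 / 4))) := by
    rw [tendsto_iff_norm_sub_tendsto_zero]
    have hlim : Tendsto (fun x : ℝ => t ^ 4 * (5 / 384) * x⁻¹) atTop (𝓝 0) := by
      simpa only [mul_zero] using
        (tendsto_inv_atTop_zero (𝕜 := ℝ)).const_mul (t ^ 4 * (5 / 384))
    refine squeeze_zero' (.of_forall fun _ => norm_nonneg _) ?_ hlim
    filter_upwards [eventually_ge_atTop (t ^ 2), eventually_gt_atTop 0] with x hx hx0
    have hsq : (t / √(2 * x)) ^ 2 = t ^ 2 / (2 * x) := by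
      rw [div_pow, Real.sq_sqrt (by positivity)]
    have hsmall : |t / √(2 * x)| ≤ 1 := by
      rw [← sq_le_one_iff_abs_le_one, hsq, div_le_one (by positivity)]
      linarith
    have hb := Real.cos_bound hsmall
    have h4 : |t / √(2 * x)| ^ 4 = (t ^ 2 / (2 * x)) ^ 2 := by
      rw [← hsq, ← pow_mul, Even.pow_abs (by decide)]
    rw [h4, hsq] at hb
    calc ‖x * (Real.cos (t / √(2 * x)) - 1) - -(t ^ 2 / 4)‖
        = x * |Real.cos (t / √(2 * x)) - (1 - t ^ 2 / (2 * x) / 2)| := by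
          rw [← abs_of_pos hx0, ← abs_mul, abs_of_pos hx0, Real.norm_eq_abs]
          congr 1; field_simp; ring
      _ ≤ x * ((t ^ 2 / (2 * x)) ^ 2 * (5 / 96)) := by gcongr
      _ = t ^ 4 * (5 / 384) * x⁻¹ := by field_simp; ring
  simpa using Real.tendsto_mul_log_one_add_of_tendsto hcos

theorem integral_pos_of_forall_pos {α : Type*} [MeasurableSpace α] {μ : Measure α} [NeZero μ]
    {f : α → ℝ} (hf : ∀ x, 0 < f x) (hint : Integrable f μ) : 0 < ∫ x, f x ∂μ := by
  rw [integral_pos_iff_support_of_nonneg (fun x => (hf x).le) hint,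
    Function.support_eq_univ fun x => (hf x).ne']
  exact Measure.measure_univ_pos.2 (NeZero.ne μ)

theorem eventually_aemeasurable_of_tendsto_integral {Ω : Type*} [MeasurableSpace Ω]
    {P : Measure Ω} {μ : Measure ℝ} [IsProbabilityMeasure μ] {Z : ℕ → Ω → ℝ}
    (hZ : ∀ f : ℝ → ℝ, Continuous f → (∃ C, ∀ x, |f x| ≤ C) →
      Tendsto (fun n => ∫ ω, f (Z n ω) ∂P) atTop (𝓝 (∫ x, f x ∂μ))) :
    ∀ᶠ n in atTop, AEMeasurable (Z n) P := by
  have hpos (x : ℝ) : 0 < (1 + Real.exp x)⁻¹ := by positivity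
  have hle (x : ℝ) : |(1 + Real.exp x)⁻¹| ≤ 1 := by
    rw [abs_of_pos (hpos x)]
    exact inv_le_one_of_one_le₀ (by linarith [Real.exp_pos x])
  have hcont : Continuous fun x : ℝ => (1 + Real.exp x)⁻¹ :=
    Continuous.inv₀ (by fun_prop) fun x => by positivity
  have hint : Integrable (fun x : ℝ => (1 + Real.exp x)⁻¹) μ :=
    .of_bound hcont.aestronglyMeasurable 1 (.of_forall hle)
  filter_upwards [(hZ _ hcont ⟨1, hle⟩).eventually_ne
    (integral_pos_of_forall_pos hpos hint).ne'] with n hn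
  have hmeas : AEMeasurable (fun ω => (1 + Real.exp (Z n ω))⁻¹) P := by
    by_contra h
    exact hn (integral_non_aestronglyMeasurable fun h' => h h'.aemeasurable)
  have hinv : Z n = fun ω => Real.log (((1 + Real.exp (Z n ω))⁻¹)⁻¹ - 1) := by
    ext ω; simp
  rw [hinv]
  fun_prop

section WeakLimit

variable {Ω : Type*} [MeasurableSpace Ω] {P : Measure Ω} [IsProbabilityMeasure P]

theorem tendsto_charFun_map_of_tendsto_integral {μ : Measure ℝ} [IsProbabilityMeasure μ]
    {Z : ℕ → Ω → ℝ} (hmeas : ∀ n, AEMeasurable (Z n) P)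
    (hZ : ∀ f : ℝ → ℝ, Continuous f → (∃ C, ∀ x, |f x| ≤ C) →
      Tendsto (fun n => ∫ ω, f (Z n ω) ∂P) atTop (𝓝 (∫ x, f x ∂μ))) (t : ℝ) :
    Tendsto (fun n => charFun (P.map (Z n)) t) atTop (𝓝 (charFun μ t)) := by
  refine ProbabilityMeasure.tendsto_iff_tendsto_charFun (μ₀ := ⟨μ, inferInstance⟩)
    (μ := fun n => ⟨P.map (Z n), Measure.isProbabilityMeasure_map (hmeas n)⟩) |>.1 ?_ t
  refine ProbabilityMeasure.tendsto_iff_forall_integral_tendsto.2 fun f => ?_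
  refine (hZ f f.continuous ⟨‖f‖, f.norm_coe_le_norm⟩).congr fun n => ?_
  exact (integral_map (hmeas n) f.continuous.aestronglyMeasurable).symm

theorem tendsto_integral_of_tendsto_charFun_map {μ : Measure ℝ} [IsProbabilityMeasure μ]
    {Z : ℕ → Ω → ℝ} (hmeas : ∀ n, AEMeasurable (Z n) P)
    (hZ : ∀ t, Tendsto (fun n => charFun (P.map (Z n)) t) atTop (𝓝 (charFun μ t)))
    {f : ℝ → ℝ} (hf : Continuous f) (hbdd : ∃ C, ∀ x, |f x| ≤ C) :
    Tendsto (fun n => ∫ ω, f (Z n ω) ∂P) atTop (𝓝 (∫ x, f x ∂μ)) := by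
  obtain ⟨C, hC⟩ := hbdd
  have hweak := ProbabilityMeasure.tendsto_of_tendsto_charFun (μ₀ := ⟨μ, inferInstance⟩)
    (μ := fun n => ⟨P.map (Z n), Measure.isProbabilityMeasure_map (hmeas n)⟩) hZ
  refine (ProbabilityMeasure.tendsto_iff_forall_integral_tendsto.1 hweak
    (BoundedContinuousFunction.ofNormedAddCommGroup f hf C hC)).congr fun n => ?_
  exact integral_map (hmeas n) hf.aestronglyMeasurable

/-- If a sequence converges weakly, then multiplying it by a null sequence gives a sequence
converging to zero in mean, after truncation at one. -/
theorem tendsto_integral_min_one_mul_abs {μ : Measure ℝ} [IsProbabilityMeasure μ]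
    {Z : ℕ → Ω → ℝ} (hmeas : ∀ n, AEMeasurable (Z n) P)
    (hZ : ∀ f : ℝ → ℝ, Continuous f → (∃ C, ∀ x, |f x| ≤ C) →
      Tendsto (fun n => ∫ ω, f (Z n ω) ∂P) atTop (𝓝 (∫ x, f x ∂μ)))
    {r : ℕ → ℝ} (hr0 : ∀ᶠ n in atTop, 0 ≤ r n) (hr : Tendsto r atTop (𝓝 0)) :
    Tendsto (fun n => ∫ ω, min 1 (r n * |Z n ω|) ∂P) atTop (𝓝 0) := by
  have hcont (δ : ℝ) : Continuous fun x : ℝ => min 1 (δ * |x|) := by fun_prop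
  have hbd {δ : ℝ} (hδ : 0 ≤ δ) (x : ℝ) : |min 1 (δ * |x|)| ≤ 1 := by
    rw [abs_of_nonneg (by positivity)]
    exact min_le_left _ _
  have hlim : Tendsto (fun δ : ℝ => ∫ x, min 1 (δ * |x|) ∂μ) (𝓝[>] 0) (𝓝 0) := by
    have h := tendsto_integral_filter_of_dominated_convergence (μ := μ) (l := 𝓝[>] (0 : ℝ))
      (F := fun δ x => min 1 (δ * |x|)) (f := fun _ => 0) (fun _ => 1)
      (.of_forall fun δ => (hcont δ).aestronglyMeasurable)
      (eventually_mem_nhdsWithin.mono fun δ hδ => .of_forall (hbd (le_of_lt hδ)))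
      (integrable_const 1) (.of_forall fun x => by
        have : Continuous fun δ : ℝ => min 1 (δ * |x|) := by fun_prop
        simpa using (this.tendsto 0).mono_left nhdsWithin_le_nhds)
    simpa using h
  refine tendsto_order.2 ⟨fun ε hε => ?_, fun ε hε => ?_⟩
  · filter_upwards [hr0] with n hn
    exact hε.trans_le (integral_nonneg fun ω => by positivity)
  · obtain ⟨δ, hδε, hδ⟩ :=
      (((tendsto_order.1 hlim).2 ε hε).and eventually_mem_nhdsWithin).exists
    have hδ : 0 < δ := hδ
    filter_upwards [hr0, (tendsto_order.1 hr).2 δ hδ,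
      (tendsto_order.1 (hZ _ (hcont δ) ⟨1, hbd hδ.le⟩)).2 ε hδε] with n hn0 hnδ hn
    refine lt_of_le_of_lt (integral_mono ?_ ?_ fun ω => ?_) hn
    · exact .of_bound (((hcont _).measurable.comp_aemeasurable (hmeas n)).aestronglyMeasurable) 1
        (.of_forall fun ω => hbd hn0 (Z n ω))
    · exact .of_bound (((hcont _).measurable.comp_aemeasurable (hmeas n)).aestronglyMeasurable) 1
        (.of_forall fun ω => hbd hδ.le (Z n ω))
    · dsimp only
      gcongr

end WeakLimit

section Thinning

variable {Ω : Type*} [MeasurableSpace Ω] {P : Measure Ω} [IsProbabilityMeasure P]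
  {K N : ℕ → Ω → ℕ} {a : ℕ → ℝ}

theorem abs_pow_sub_exp_le {c α : ℝ} (hc0 : 0 < c) (hc1 : c ≤ 1) (hα : 0 < α) (k : ℕ) :
    |c ^ k - Real.exp (α * Real.log c)|
      ≤ min 1 ((-(α * Real.log c)) / √α * |((k : ℝ) - α) / √α|) := by
  have hlog : Real.log c ≤ 0 := Real.log_nonpos hc0.le hc1
  have hpow : c ^ k = Real.exp (-(k * -Real.log c)) := by
    rw [mul_neg, neg_neg, mul_comm, ← Real.rpow_def_of_pos hc0, Real.rpow_natCast]
  have hα' : Real.exp (α * Real.log c) = Real.exp (-(α * -Real.log c)) := by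
    rw [mul_neg, neg_neg]
  rw [hpow, hα']
  refine (abs_exp_neg_sub_exp_neg_le (mul_nonneg k.cast_nonneg (neg_nonneg.2 hlog))
    (mul_nonneg hα.le (neg_nonneg.2 hlog))).trans_eq ?_
  congr 1
  rw [← sub_mul, abs_mul, abs_of_nonneg (neg_nonneg.2 hlog), abs_div,
    abs_of_pos (Real.sqrt_pos.2 hα)]
  field_simp
  rw [Real.sq_sqrt hα.le]
  ring

theorem tendsto_integral_abs_cos_pow_sub (ha0 : ∀ n, 0 < a n) (ha : Tendsto a atTop atTop)
    (hK : ∀ n, AEMeasurable (K n) P) {μ : Measure ℝ} [IsProbabilityMeasure μ]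
    (hZ : ∀ f : ℝ → ℝ, Continuous f → (∃ C, ∀ x, |f x| ≤ C) →
      Tendsto (fun n => ∫ ω, f ((K n ω - a n) / √(a n)) ∂P) atTop (𝓝 (∫ x, f x ∂μ))) (t : ℝ) :
    Tendsto (fun n => ∫ ω, |Real.cos (t / √(2 * a n)) ^ K n ω - Real.exp (-(t ^ 2 / 4))| ∂P)
      atTop (𝓝 0) := by
  set c : ℕ → ℝ := fun n => Real.cos (t / √(2 * a n))
  have hlog : Tendsto (fun n => a n * Real.log (c n)) atTop (𝓝 (-(t ^ 2 / 4))) :=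
    (tendsto_mul_log_cos_div_sqrt t).comp ha
  have hsqrt : Tendsto (fun n => √(a n)) atTop atTop := Real.tendsto_sqrt_atTop.comp ha
  have hcpos : ∀ᶠ n in atTop, 0 < c n := by
    have harg : Tendsto (fun n => t / √(2 * a n)) atTop (𝓝 0) :=
      tendsto_const_nhds.div_atTop
        (Real.tendsto_sqrt_atTop.comp (ha.const_mul_atTop two_pos))
    have := (Real.continuous_cos.tendsto 0).comp harg
    rw [Real.cos_zero] at this
    exact this.eventually_const_lt one_pos
  have hmin := tendsto_integral_min_one_mul_abs (P := P)
    (Z := fun n ω => ((K n ω : ℝ) - a n) / √(a n)) (fun n => by fun_prop) hZ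
    (r := fun n => -(a n * Real.log (c n)) / √(a n))
    (hcpos.mono fun n hn => div_nonneg (neg_nonneg.2 (mul_nonpos_of_nonneg_of_nonpos (ha0 n).le
      (Real.log_nonpos hn.le (Real.cos_le_one _)))) (Real.sqrt_nonneg _))
    (hlog.neg.div_atTop hsqrt)
  have hexp : Tendsto (fun n => |Real.exp (a n * Real.log (c n)) - Real.exp (-(t ^ 2 / 4))|)
      atTop (𝓝 0) := by
    have := ((Real.continuous_exp.tendsto _).comp hlog).sub_const (Real.exp (-(t ^ 2 / 4)))
    simpa using this.abs
  refine squeeze_zero' (.of_forall fun n => integral_nonneg fun ω => abs_nonneg _) ?_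
    (by simpa using hmin.add hexp)
  filter_upwards [hcpos] with n hn
  have hr0 : 0 ≤ -(a n * Real.log (c n)) / √(a n) :=
    div_nonneg (neg_nonneg.2 (mul_nonpos_of_nonneg_of_nonpos (ha0 n).le
      (Real.log_nonpos hn.le (Real.cos_le_one _)))) (Real.sqrt_nonneg _)
  have hint : Integrable (fun ω => min 1
      (-(a n * Real.log (c n)) / √(a n) * |((K n ω : ℝ) - a n) / √(a n)|)) P := by
    refine .of_bound (AEMeasurable.aestronglyMeasurable (by fun_prop)) 1 (.of_forall fun ω => ?_)
    rw [Real.norm_of_nonneg (by positivity)]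
    exact min_le_left _ _
  calc ∫ ω, |c n ^ K n ω - Real.exp (-(t ^ 2 / 4))| ∂P
      ≤ ∫ ω, (min 1 (-(a n * Real.log (c n)) / √(a n) * |((K n ω : ℝ) - a n) / √(a n)|)
        + |Real.exp (a n * Real.log (c n)) - Real.exp (-(t ^ 2 / 4))|) ∂P := by
        refine integral_mono_of_nonneg (.of_forall fun ω => abs_nonneg _)
          (hint.add (integrable_const _)) (.of_forall fun ω => ?_)
        exact (abs_sub_le _ (Real.exp (a n * Real.log (c n))) _).trans
          (add_le_add_left (abs_pow_sub_exp_le hn (Real.cos_le_one _) (ha0 n) (K n ω)) _)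
    _ = _ := by rw [integral_add hint (integrable_const _)]; simp

theorem one_add_exp_two_mul_mul_I_div_two (u : ℝ) :
    (1 + Complex.exp ((2 * u : ℝ) * Complex.I)) / 2
      = Complex.exp (u * Complex.I) * (Real.cos u : ℂ) := by
  have h0 : (u : ℂ) * Complex.I + -u * Complex.I = 0 := by ring
  have h2 : (u : ℂ) * Complex.I + u * Complex.I = (2 * u : ℝ) * Complex.I := by
    push_cast; ring
  rw [Complex.ofReal_cos, Complex.cos, mul_div_assoc', mul_add, ← Complex.exp_add,
    ← Complex.exp_add, h0, h2, Complex.exp_zero, add_comm]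

theorem charFun_map_of_binomial {K N : Ω → ℕ} {α : ℝ} (hα : 0 < α) (hK : AEMeasurable K P)
    (hbin : ∀ k m : ℕ, P {ω | K ω = k ∧ N ω = m}
      = P {ω | K ω = k} * ENNReal.ofReal ((k.choose m : ℝ) * (1 / 2) ^ k)) (t : ℝ) :
    charFun (P.map fun ω => ((N ω : ℝ) - α / 2) / √(α / 2)) t
      = ∫ ω, Complex.exp (t / √2 * (((K ω - α) / √α : ℝ) : ℂ) * Complex.I)
        * (Real.cos (t / √(2 * α)) : ℂ) ^ K ω ∂P := by
  have hN : AEMeasurable N P := (aemeasurable_prodMk_of_binomial hK hbin).snd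
  have h2 : √2 * √2 = 2 := Real.mul_self_sqrt zero_le_two
  have hs2 : 0 < √2 := by positivity
  have hsα : 0 < √α := by positivity
  have hsh : √(α / 2) = √α / √2 := Real.sqrt_div hα.le 2
  have hsd : √(2 * α) = √2 * √α := Real.sqrt_mul zero_le_two α
  set u : ℝ := t / √(2 * α) with hu
  have hfactor (x : ℝ) : (t : ℂ) * (((x - α / 2) / √(α / 2) : ℝ) : ℂ) * Complex.I
      = ((-(u * α) : ℝ) : ℂ) * Complex.I + x * ((2 * u : ℝ) * Complex.I) := by
    have : t * ((x - α / 2) / √(α / 2)) = -(u * α) + x * (2 * u) := by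
      rw [hu, hsh, hsd]
      field_simp
      linear_combination (t * (x * 2 - α)) * h2
    rw [← Complex.ofReal_mul, this]
    push_cast; ring
  rw [charFun_apply_real, integral_map (by fun_prop) (by fun_prop)]
  simp_rw [hfactor, Complex.exp_add, Complex.ofReal_natCast, Complex.exp_nat_mul]
  rw [integral_const_mul, integral_pow_of_binomial hK hbin
    (by rw [Complex.norm_exp_ofReal_mul_I]), ← integral_const_mul,
    one_add_exp_two_mul_mul_I_div_two]
  refine integral_congr_ae (.of_forall fun ω => ?_)
  dsimp only
  rw [mul_pow, ← mul_assoc, ← Complex.exp_nat_mul, ← Complex.exp_add]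
  congr 2
  have : -(u * α) + K ω * u = t / √2 * ((K ω - α) / √α) := by
    rw [hu, hsd]; field_simp; ring
  rw [← Complex.ofReal_div, ← Complex.ofReal_mul, ← this]
  push_cast; ring

theorem tendsto_charFun_of_binomial (ha0 : ∀ n, 0 < a n) (ha : Tendsto a atTop atTop)
    (hK : ∀ n, AEMeasurable (K n) P)
    (hbin : ∀ n (k m : ℕ), P {ω | K n ω = k ∧ N n ω = m}
      = P {ω | K n ω = k} * ENNReal.ofReal ((k.choose m : ℝ) * (1 / 2) ^ k))
    (hZ : ∀ f : ℝ → ℝ, Continuous f → (∃ C, ∀ x, |f x| ≤ C) →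
      Tendsto (fun n => ∫ ω, f ((K n ω - a n) / √(a n)) ∂P) atTop
        (𝓝 (∫ x, f x ∂(gaussianReal 0 1)))) (t : ℝ) :
    Tendsto (fun n => charFun (P.map fun ω => ((N n ω : ℝ) - a n / 2) / √(a n / 2)) t) atTop
      (𝓝 (charFun (gaussianReal 0 1) t)) := by
  have hmeas (n : ℕ) : AEMeasurable (fun ω => ((K n ω : ℝ) - a n) / √(a n)) P := by fun_prop
  have hlim := (tendsto_charFun_map_of_tendsto_integral hmeas hZ (t / √2)).mul_const
    ((Real.exp (-(t ^ 2 / 4)) : ℝ) : ℂ)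
  have hgauss : charFun (gaussianReal 0 1) (t / √2) * ((Real.exp (-(t ^ 2 / 4)) : ℝ) : ℂ)
      = charFun (gaussianReal 0 1) t := by
    have h2 : ((√2 : ℝ) : ℂ) ^ 2 = 2 := by
      rw [← Complex.ofReal_pow, Real.sq_sqrt zero_le_two]; simp
    rw [charFun_gaussianReal, charFun_gaussianReal, Complex.ofReal_exp, ← Complex.exp_add]
    congr 1
    push_cast
    rw [div_pow, h2]
    ring
  rw [hgauss] at hlim
  refine tendsto_of_tendsto_of_dist hlim ?_
  refine squeeze_zero (fun _ => dist_nonneg) (fun n => ?_)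
    (tendsto_integral_abs_cos_pow_sub ha0 ha hK hZ t)
  have hint (g : Ω → ℂ) (hg : AEMeasurable g P) (hg1 : ∀ ω, ‖g ω‖ ≤ 1) :
      Integrable (fun ω => Complex.exp (t / √2 * ((((K n ω : ℝ) - a n) / √(a n) : ℝ) : ℂ)
        * Complex.I) * g ω) P := by
    refine .of_bound (AEMeasurable.aestronglyMeasurable (by fun_prop)) 1 (.of_forall fun ω => ?_)
    rw [norm_mul, ← Complex.ofReal_div, ← Complex.ofReal_mul, Complex.norm_exp_ofReal_mul_I,
      one_mul]
    exact hg1 ω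
  rw [dist_comm, dist_eq_norm, charFun_map_of_binomial (ha0 n) (hK n) (hbin n), charFun_apply_real,
    integral_map (hmeas n) (by fun_prop), ← integral_mul_const]
  rw [Complex.ofReal_div t]
  rw [← integral_sub (hint _ (by fun_prop) fun ω => ?_) (hint _ (by fun_prop) fun ω => ?_)]
  · refine (norm_integral_le_integral_norm _).trans_eq
      (integral_congr_ae (.of_forall fun ω => ?_))
    dsimp only
    rw [← mul_sub, norm_mul, ← Complex.ofReal_div, ← Complex.ofReal_mul,
      Complex.norm_exp_ofReal_mul_I, one_mul, ← Complex.ofReal_pow, ← Complex.ofReal_sub,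
      Complex.norm_real, Real.norm_eq_abs]
  · rw [norm_pow, Complex.norm_real]
    exact pow_le_one₀ (norm_nonneg _) (Real.abs_cos_le_one _)
  · rw [Complex.norm_real, Real.norm_of_nonneg (Real.exp_pos _).le]
    exact Real.exp_le_one_iff.2 (by nlinarith [sq_nonneg t])

end Thinning

/-- if `X n` is ℕ-valued, `Y n` is conditionally binomial `(X n, 1/2)`,
and `(X n - a n)/√(a n)` converges in distribution to a standard Gaussian with
`a n → ∞`, then `(Y n - a n / 2)/√(a n / 2)` converges in distribution to a standard
Gaussian. -/
theorem stmt_1 {Ω : Type*} [MeasurableSpace Ω] (Pm : Measure Ω) [IsProbabilityMeasure Pm]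
    (X Y : ℕ → Ω → ℝ) (a : ℕ → ℝ)
    (hXnat : ∀ n, ∀ᵐ ω ∂Pm, ∃ k : ℕ, X n ω = k)
    (hYnat : ∀ n, ∀ᵐ ω ∂Pm, ∃ m : ℕ, Y n ω = m)
    (hbin : ∀ n (k m : ℕ),
      Pm {ω | X n ω = k ∧ Y n ω = m}
        = Pm {ω | X n ω = k} * ENNReal.ofReal ((k.choose m : ℝ) * (1 / 2) ^ k))
    (ha : Tendsto a atTop atTop)
    (hX : ∀ f : ℝ → ℝ, Continuous f → (∃ C, ∀ x, |f x| ≤ C) →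
      Tendsto (fun n => ∫ ω, f ((X n ω - a n) / Real.sqrt (a n)) ∂Pm) atTop
        (𝓝 (∫ x, f x ∂(gaussianReal 0 1)))) :
    ∀ f : ℝ → ℝ, Continuous f → (∃ C, ∀ x, |f x| ≤ C) →
      Tendsto (fun n => ∫ ω, f ((Y n ω - a n / 2) / Real.sqrt (a n / 2)) ∂Pm) atTop
        (𝓝 (∫ x, f x ∂(gaussianReal 0 1))) := by
  have hmeas := eventually_aemeasurable_of_tendsto_integral (P := Pm) (μ := gaussianReal 0 1) hX
  obtain ⟨n₀, hn₀⟩ := eventually_atTop.1 (hmeas.and (ha.eventually_gt_atTop 0))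
  have hXfloor (n : ℕ) : ∀ᵐ ω ∂Pm, X n ω = ⌊X n ω⌋₊ := by
    filter_upwards [hXnat n] with ω ⟨k, hk⟩
    simp [hk]
  have hYfloor (n : ℕ) : ∀ᵐ ω ∂Pm, Y n ω = ⌊Y n ω⌋₊ := by
    filter_upwards [hYnat n] with ω ⟨k, hk⟩
    simp [hk]
  let K (n : ℕ) (ω : Ω) : ℕ := ⌊X (n + n₀) ω⌋₊
  let N (n : ℕ) (ω : Ω) : ℕ := ⌊Y (n + n₀) ω⌋₊
  have hK (n : ℕ) : AEMeasurable (K n) Pm := by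
    obtain ⟨hZ, hpos⟩ := hn₀ (n + n₀) (Nat.le_add_left _ _)
    have hX' : X (n + n₀) = fun ω => (X (n + n₀) ω - a (n + n₀)) / √(a (n + n₀))
        * √(a (n + n₀)) + a (n + n₀) := by
      ext ω
      rw [div_mul_cancel₀ _ (Real.sqrt_pos.2 hpos).ne', sub_add_cancel]
    refine Nat.measurable_floor.comp_aemeasurable ?_
    rw [hX']
    exact (hZ.mul_const _).add_const _
  have hbin' (n k m : ℕ) : Pm {ω | K n ω = k ∧ N n ω = m}
      = Pm {ω | K n ω = k} * ENNReal.ofReal ((k.choose m : ℝ) * (1 / 2) ^ k) := by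
    have hset : Pm {ω | K n ω = k} = Pm {ω | X (n + n₀) ω = k} := by
      refine measure_congr (eventuallyEq_set.2 ?_)
      filter_upwards [hXfloor (n + n₀)] with ω hω
      rw [hω, Nat.cast_inj]
    rw [hset, ← hbin]
    refine measure_congr (eventuallyEq_set.2 ?_)
    filter_upwards [hXfloor (n + n₀), hYfloor (n + n₀)] with ω hω hω'
    rw [hω, hω', Nat.cast_inj, Nat.cast_inj]
  have hZ (f : ℝ → ℝ) (hf : Continuous f) (hb : ∃ C, ∀ x, |f x| ≤ C) :
      Tendsto (fun n => ∫ ω, f ((K n ω - a (n + n₀)) / √(a (n + n₀))) ∂Pm) atTop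
        (𝓝 (∫ x, f x ∂(gaussianReal 0 1))) := by
    refine ((tendsto_add_atTop_iff_nat n₀).2 (hX f hf hb)).congr fun n => integral_congr_ae ?_
    filter_upwards [hXfloor (n + n₀)] with ω hω
    rw [← hω]
  have hpos (n : ℕ) : 0 < a (n + n₀) := (hn₀ (n + n₀) (Nat.le_add_left _ _)).2
  have hN (n : ℕ) :
      AEMeasurable (fun ω => ((N n ω : ℝ) - a (n + n₀) / 2) / √(a (n + n₀) / 2)) Pm := by
    have := (aemeasurable_prodMk_of_binomial (hK n) (hbin' n)).snd
    fun_prop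
  intro f hf hb
  refine (tendsto_add_atTop_iff_nat n₀).1 ?_
  refine (tendsto_integral_of_tendsto_charFun_map hN (tendsto_charFun_of_binomial hpos
    ((tendsto_add_atTop_iff_nat n₀).2 ha) hK hbin' hZ) hf hb).congr fun n => integral_congr_ae ?_
  filter_upwards [hYfloor (n + n₀)] with ω hω
  rw [← hω]
end

section
/- Fix κ ≥ 2 and n ≥ 1, and let (N̄₁,…,N̄_κ) be the numbers of internal nodes in the κ subtrees of the root of the random recursive κ-ary tree with n internal nodes. Then for all nonnegative integers n₁,…,n_κ summing to n−1, P((N̄₁,…,N̄_κ) = (n₁,…,n_κ)) = (n−1 choose n₁,…,n_κ) · (1/Γ(1 + n(κ−1))) · ∏_{i=1}^κ Γ(κ n_i + 1)/(Γ(n_i + 1) Γ((κ−1)n_i + 2)) · Γ(2), up to the correct normalisation; equivalently, this subtree-size distribution coincides with the Dirichlet-multinomial distribution with parameter α = 1/(κ−1). -/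
open scoped ENNReal

/-- Uniform distribution on a finite set of words (junk value if empty). -/
noncomputable def unifOrN (s : Finset (List ℕ)) : PMF (List ℕ) :=
  if h : s.Nonempty then PMF.uniformOfFinset s h else PMF.pure []

/-- The random recursive κ-ary tree `T_n^κ`: start from a single leaf (the root) and, at
each step, pick a leaf uniformly at random and give it κ children. Trees are recorded as
their sets of internal nodes together with the root. -/
noncomputable def karyPMF (κ : ℕ) : ℕ → PMF (Finset (List ℕ))
  | 0 => PMF.pure {([] : List ℕ)}
  | n + 1 => (karyPMF κ n).bind fun t =>
      (unifOrN (t.filter (fun u => u ++ [0] ∉ t))).map fun u =>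
        t ∪ (Finset.range κ).image (fun j => u ++ [j])

/-- Number of internal nodes in the subtree rooted at the `j`-th child of the root. -/
def subCount (t : Finset (List ℕ)) (j : ℕ) : ℕ :=
  (t.filter (fun u => u.head? = some j ∧ u ++ [0] ∈ t)).card

/-- The leaves of a tree. -/
def treeLeaves (t : Finset (List ℕ)) : Finset (List ℕ) :=
  t.filter (fun u => u ++ [0] ∉ t)

/-- The tree obtained from `t` by giving `κ` children to the node `u`. -/
def treeGrow (κ : ℕ) (t : Finset (List ℕ)) (u : List ℕ) : Finset (List ℕ) :=
  t ∪ (Finset.range κ).image (fun j => u ++ [j])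

/-- Number of leaves in the subtree rooted at the `j`-th child of the root. -/
def leafCount (t : Finset (List ℕ)) (j : ℕ) : ℕ :=
  ((treeLeaves t).filter (fun u => u.head? = some j)).card

/-- A `κ`-ary tree with `n + 1` internal nodes. -/
structure IsKaryTree (κ n : ℕ) (t : Finset (List ℕ)) : Prop where
  closed : ∀ u i, u ++ [i] ∈ t → u ++ [0] ∈ t ∧ u ∈ t
  head_lt : ∀ i l, i :: l ∈ t → i < κ
  root_internal : [0] ∈ t
  leafCount_eq : ∀ j < κ, leafCount t j = 1 + (κ - 1) * subCount t j
  sum_subCount : ∑ j ∈ Finset.range κ, subCount t j = n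

lemma mem_treeLeaves {t : Finset (List ℕ)} {u : List ℕ} :
    u ∈ treeLeaves t ↔ u ∈ t ∧ u ++ [0] ∉ t := by
  simp [treeLeaves]

lemma mem_treeGrow {κ : ℕ} {t : Finset (List ℕ)} {u v : List ℕ} :
    v ∈ treeGrow κ t u ↔ v ∈ t ∨ ∃ j < κ, u ++ [j] = v := by
  simp [treeGrow]

lemma snoc_mem_treeGrow {κ : ℕ} {t : Finset (List ℕ)} {u v : List ℕ} {i : ℕ} :
    v ++ [i] ∈ treeGrow κ t u ↔ v ++ [i] ∈ t ∨ (v = u ∧ i < κ) := by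
  rw [mem_treeGrow]
  constructor
  · rintro (h | ⟨j, hj, h⟩)
    · exact Or.inl h
    · obtain ⟨h1, h2⟩ := List.append_inj' h rfl
      simp only [List.cons.injEq, and_true] at h2
      exact Or.inr ⟨h1.symm, h2 ▸ hj⟩
  · rintro (h | ⟨h, hi⟩)
    · exact Or.inl h
    · exact Or.inr ⟨i, hi, by rw [h]⟩

namespace IsKaryTree

variable {κ n : ℕ} {t : Finset (List ℕ)} {u : List ℕ}

lemma ne_nil_of_leaf (h : IsKaryTree κ n t) (hu : u ∈ treeLeaves t) : u ≠ [] := by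
  rintro rfl
  exact (mem_treeLeaves.1 hu).2 h.root_internal

lemma exists_head (h : IsKaryTree κ n t) (hu : u ∈ treeLeaves t) :
    ∃ j : Fin κ, u.head? = some (j : ℕ) := by
  cases u with
  | nil => exact absurd rfl (h.ne_nil_of_leaf hu)
  | cons i l => exact ⟨⟨i, h.head_lt i l (mem_treeLeaves.1 hu).1⟩, rfl⟩

lemma subCount_grow (h : IsKaryTree κ n t) (hκ : 0 < κ) (hu : u ∈ treeLeaves t) (j : ℕ) :
    subCount (treeGrow κ t u) j = subCount t j + if u.head? = some j then 1 else 0 := by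
  obtain ⟨hut, hu0⟩ := mem_treeLeaves.1 hu
  have key : (treeGrow κ t u).filter
        (fun v => v.head? = some j ∧ v ++ [0] ∈ treeGrow κ t u) =
      t.filter (fun v => v.head? = some j ∧ v ++ [0] ∈ t) ∪
        if u.head? = some j then {u} else ∅ := by
    ext v
    have h1 := h.closed v 0
    split_ifs with hj <;>
    · simp only [Finset.mem_filter, Finset.mem_union, snoc_mem_treeGrow, Finset.mem_singleton,
        Finset.notMem_empty]
      have h2 : v ∈ t → v ∈ treeGrow κ t u := fun hv => mem_treeGrow.2 (Or.inl hv)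
      by_cases hvu : v = u
      · subst hvu; tauto
      · tauto
  unfold subCount
  rw [key, Finset.card_union_of_disjoint]
  · split_ifs <;> simp
  · split_ifs
    · simp [hu0]
    · simp

lemma leaves_grow (h : IsKaryTree κ n t) (hκ : 0 < κ) (hu : u ∈ treeLeaves t) :
    treeLeaves (treeGrow κ t u) =
      (treeLeaves t).erase u ∪ (Finset.range κ).image (fun j => u ++ [j]) := by
  obtain ⟨hut, hu0⟩ := mem_treeLeaves.1 hu
  ext v
  simp only [mem_treeLeaves, snoc_mem_treeGrow, Finset.mem_union, Finset.mem_erase,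
    Finset.mem_image, Finset.mem_range]
  rw [mem_treeGrow]
  constructor
  · tauto
  · rintro (⟨h1, h2, h3⟩ | ⟨j, hj, rfl⟩)
    · tauto
    · refine ⟨Or.inr ⟨j, hj, rfl⟩, ?_⟩
      rintro (h1 | ⟨h1, -⟩)
      · exact hu0 (h.closed _ _ (h.closed _ _ h1).2).1
      · simp at h1

lemma leafCount_grow (h : IsKaryTree κ n t) (hκ : 0 < κ) (hu : u ∈ treeLeaves t) (j : ℕ) :
    leafCount (treeGrow κ t u) j =
      leafCount t j + if u.head? = some j then κ - 1 else 0 := by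
  obtain ⟨hut, hu0⟩ := mem_treeLeaves.1 hu
  have hne := h.ne_nil_of_leaf hu
  have hhead : ∀ i, (u ++ [i]).head? = u.head? := by
    intro i
    cases u with
    | nil => exact absurd rfl hne
    | cons => rfl
  have hinj : Function.Injective (fun j : ℕ => u ++ [j]) := by
    intro a b hab
    simpa using hab
  unfold leafCount
  rw [h.leaves_grow hκ hu, Finset.filter_union, Finset.card_union_of_disjoint,
    Finset.filter_image, Finset.card_image_of_injective _ hinj, Finset.filter_erase]
  · simp only [hhead]
    split_ifs with hj
    · have hmem : u ∈ (treeLeaves t).filter (fun v => v.head? = some j) :=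
        Finset.mem_filter.2 ⟨hu, hj⟩
      have := Finset.card_pos.2 ⟨u, hmem⟩
      rw [Finset.card_erase_of_mem hmem]
      simp [hj]
      omega
    · rw [Finset.erase_eq_of_notMem (by simp [hj])]
      simp [hj]
  · apply Finset.disjoint_filter_filter
    rw [Finset.disjoint_left]
    intro v hv hv'
    obtain ⟨i, -, rfl⟩ := Finset.mem_image.1 hv'
    have := (mem_treeLeaves.1 (Finset.mem_of_mem_erase hv)).1
    exact hu0 (h.closed _ _ this).1

lemma grow (h : IsKaryTree κ n t) (hκ : 0 < κ) (hu : u ∈ treeLeaves t) :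
    IsKaryTree κ (n + 1) (treeGrow κ t u) where
  closed v i hv := by
    rw [snoc_mem_treeGrow] at hv ⊢
    rw [mem_treeGrow]
    have hut := (mem_treeLeaves.1 hu).1
    rcases hv with hv | ⟨rfl, hi⟩
    · have := h.closed v i hv
      tauto
    · tauto
  head_lt i l hv := by
    rcases mem_treeGrow.1 hv with hv | ⟨j, hj, hv⟩
    · exact h.head_lt i l hv
    · have hut := (mem_treeLeaves.1 hu).1
      cases u with
      | nil => exact absurd rfl (h.ne_nil_of_leaf hu)
      | cons a l' =>
        simp only [List.cons_append, List.cons.injEq] at hv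
        exact hv.1 ▸ h.head_lt _ _ hut
  root_internal := mem_treeGrow.2 (Or.inl h.root_internal)
  leafCount_eq j hj := by
    rw [h.leafCount_grow hκ hu, h.subCount_grow hκ hu, h.leafCount_eq j hj]
    split_ifs
    · ring
    · ring
  sum_subCount := by
    simp_rw [h.subCount_grow hκ hu]
    rw [Finset.sum_add_distrib, h.sum_subCount]
    obtain ⟨j, hj⟩ := h.exists_head hu
    simp [hj]

lemma sum_fin_subCount (h : IsKaryTree κ n t) : ∑ j : Fin κ, subCount t j = n := by
  rw [Fin.sum_univ_eq_sum_range (fun j => subCount t j), h.sum_subCount]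

/-- Decompose a count of leaves according to the subtree of the root that they belong to. -/
lemma card_filter_leaves (h : IsKaryTree κ n t) (p : List ℕ → Prop) [DecidablePred p]
    (q : Fin κ → Prop) [DecidablePred q]
    (hpq : ∀ u ∈ treeLeaves t, ∀ j : Fin κ, u.head? = some (j : ℕ) → (p u ↔ q j)) :
    ((treeLeaves t).filter p).card =
      ∑ j : Fin κ, if q j then 1 + (κ - 1) * subCount t j else 0 := by
  have h1 : ∀ j : Fin κ, (if q j then 1 + (κ - 1) * subCount t j else 0) =
      ∑ u ∈ treeLeaves t, if u.head? = some (j : ℕ) ∧ q j then 1 else 0 := by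
    intro j
    rw [← h.leafCount_eq j j.2, leafCount]
    split_ifs with hq <;> simp [hq]
  simp_rw [h1]
  rw [Finset.sum_comm, Finset.card_filter]
  refine Finset.sum_congr rfl fun u hu => ?_
  obtain ⟨j, hj⟩ := h.exists_head hu
  rw [Finset.sum_eq_single j]
  · simp [hj, hpq u hu j hj]
  · intro i _ hij
    rw [if_neg]
    rintro ⟨hi, -⟩
    rw [hj] at hi
    exact hij (Fin.ext (Option.some.inj hi).symm)
  · simp

lemma card_leaves (h : IsKaryTree κ n t) : (treeLeaves t).card = κ + (κ - 1) * n := by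
  have := h.card_filter_leaves (fun _ => True) (fun _ => True) (by simp)
  simp only [Finset.filter_true, if_true] at this
  rw [this, Finset.sum_add_distrib, ← Finset.mul_sum, h.sum_fin_subCount]
  simp

end IsKaryTree

lemma isKaryTree_star {κ : ℕ} (hκ : 0 < κ) : IsKaryTree κ 0 (treeGrow κ {[]} []) := by
  have hmem : ∀ v, v ∈ treeGrow κ {[]} [] ↔ v = [] ∨ ∃ j < κ, [j] = v := by
    intro v; simp [mem_treeGrow]
  have hsnoc : ∀ v i, v ++ [i] ∈ treeGrow κ {[]} [] ↔ v = [] ∧ i < κ := by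
    intro v i; simp [snoc_mem_treeGrow]
  have hsub : ∀ j, subCount (treeGrow κ {[]} []) j = 0 := by
    intro j
    rw [subCount, Finset.card_eq_zero, Finset.filter_eq_empty_iff]
    rintro v - ⟨h1, h2⟩
    rw [((hsnoc _ _).1 h2).1] at h1
    simp at h1
  refine ⟨?_, ?_, ?_, ?_, ?_⟩
  · intro u i h
    rw [hsnoc] at h ⊢
    rw [hmem]
    tauto
  · intro i l h
    rcases (hmem _).1 h with h | ⟨j, hj, h⟩
    · simp at h
    · simp only [List.cons.injEq] at h
      omega
  · exact (hmem _).2 (Or.inr ⟨0, hκ, rfl⟩)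
  · intro j hj
    rw [hsub, leafCount, mul_zero, add_zero, Finset.card_eq_one]
    refine ⟨[j], ?_⟩
    ext v
    simp only [Finset.mem_filter, mem_treeLeaves, hsnoc, hmem, Finset.mem_singleton]
    constructor
    · rintro ⟨⟨rfl | ⟨i, hi, rfl⟩, -⟩, h⟩
      · simp at h
      · simpa using h
    · rintro rfl
      simpa using hj
  · simp [hsub]

lemma unifOrN_of_nonempty {s : Finset (List ℕ)} (h : s.Nonempty) :
    unifOrN s = PMF.uniformOfFinset s h := by
  simp [unifOrN, h]

lemma karyPMF_succ (κ n : ℕ) : karyPMF κ (n + 1) =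
    (karyPMF κ n).bind fun t => (unifOrN (treeLeaves t)).map (treeGrow κ t) := rfl

lemma karyPMF_one (κ : ℕ) : karyPMF κ 1 = PMF.pure (treeGrow κ {[]} []) := by
  have h : treeLeaves {[]} = {[]} := by decide
  rw [karyPMF_succ, karyPMF, PMF.pure_bind, h, unifOrN_of_nonempty (Finset.singleton_nonempty _)]
  have : PMF.uniformOfFinset {([] : List ℕ)} (Finset.singleton_nonempty _) = PMF.pure [] := by
    ext v
    simp [PMF.uniformOfFinset_apply, PMF.pure_apply]
  rw [this, PMF.pure_map]

lemma isKaryTree_of_mem_support {κ : ℕ} (hκ : 0 < κ) (n : ℕ) (t : Finset (List ℕ))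
    (ht : t ∈ (karyPMF κ (n + 1)).support) : IsKaryTree κ n t := by
  induction n generalizing t with
  | zero =>
    rw [zero_add, karyPMF_one, PMF.support_pure, Set.mem_singleton_iff] at ht
    exact ht ▸ isKaryTree_star hκ
  | succ n ih =>
    rw [karyPMF_succ, PMF.mem_support_bind_iff] at ht
    obtain ⟨s, hs, ht⟩ := ht
    have hs := ih s hs
    have hne : (treeLeaves s).Nonempty := by
      rw [← Finset.card_pos, hs.card_leaves]
      omega
    rw [unifOrN_of_nonempty hne, PMF.mem_support_map_iff] at ht
    obtain ⟨u, hu, rfl⟩ := ht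
    exact hs.grow hκ ((PMF.mem_support_uniformOfFinset_iff hne u).1 hu)

/-- The trees whose vector of subtree sizes at the root is `w`. -/
def sizeEvent {κ : ℕ} (w : Fin κ → ℕ) : Set (Finset (List ℕ)) :=
  {t | ∀ j : Fin κ, subCount t (j : ℕ) = w j}

/-- One step of the random recursive tree acts on subtree sizes as a Pólya urn. -/
lemma step_sizeEvent {κ n : ℕ} (hκ : 0 < κ) {t : Finset (List ℕ)} (h : IsKaryTree κ n t)
    (w : Fin κ → ℕ) :
    ((unifOrN (treeLeaves t)).map (treeGrow κ t)).toOuterMeasure (sizeEvent w) =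
      ∑ j : Fin κ, (if w j = 0 then 0 else
        ((1 + (κ - 1) * (w j - 1) : ℕ) : ℝ≥0∞) / ((κ + (κ - 1) * n : ℕ) : ℝ≥0∞)) *
        (sizeEvent (Function.update w j (w j - 1))).indicator 1 t := by
  classical
  have hne : (treeLeaves t).Nonempty := by
    rw [← Finset.card_pos, h.card_leaves]
    omega
  rw [unifOrN_of_nonempty hne, PMF.toOuterMeasure_map_apply,
    PMF.toOuterMeasure_uniformOfFinset_apply, h.card_leaves,
    h.card_filter_leaves _
      (fun j => w j ≠ 0 ∧ t ∈ sizeEvent (Function.update w j (w j - 1))), Nat.cast_sum,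
    div_eq_mul_inv, Finset.sum_mul]
  · refine Finset.sum_congr rfl fun j _ => ?_
    by_cases h0 : w j = 0
    · simp [h0]
    by_cases h1 : t ∈ sizeEvent (Function.update w j (w j - 1))
    · have := h1 j
      rw [Function.update_self] at this
      rw [if_pos ⟨h0, h1⟩, if_neg h0, Set.indicator_of_mem h1, this, div_eq_mul_inv]
      simp
    · simp [h1]
  · intro u hu j hj
    simp only [Set.mem_preimage, sizeEvent, Set.mem_ofPred_eq, h.subCount_grow hκ hu, hj,
      Option.some.injEq]
    constructor
    · intro H
      have hjj := H j
      simp only [if_true] at hjj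
      refine ⟨by omega, fun i => ?_⟩
      have hi := H i
      by_cases hij : i = j
      · subst hij
        rw [Function.update_self]
        omega
      · rw [Function.update_of_ne hij]
        rwa [if_neg (fun e => hij (Fin.ext e.symm)), add_zero] at hi
    · rintro ⟨h0, H⟩ i
      have hi := H i
      by_cases hij : i = j
      · subst hij
        rw [Function.update_self] at hi
        rw [if_pos rfl]
        omega
      · rw [Function.update_of_ne hij] at hi
        rwa [if_neg (fun e => hij (Fin.ext e.symm)), add_zero]

lemma karyPMF_succ_sizeEvent {κ : ℕ} (hκ : 0 < κ) (n : ℕ) (w : Fin κ → ℕ) :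
    (karyPMF κ (n + 2)).toOuterMeasure (sizeEvent w) =
      ∑ j : Fin κ, (if w j = 0 then 0 else
        ((1 + (κ - 1) * (w j - 1) : ℕ) : ℝ≥0∞) / ((κ + (κ - 1) * n : ℕ) : ℝ≥0∞)) *
        (karyPMF κ (n + 1)).toOuterMeasure (sizeEvent (Function.update w j (w j - 1))) := by
  rw [karyPMF_succ, PMF.toOuterMeasure_bind_apply]
  simp_rw [PMF.toOuterMeasure_apply (karyPMF κ (n + 1)), ← ENNReal.tsum_mul_left]
  rw [← Summable.tsum_finsetSum (fun _ _ => ENNReal.summable)]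
  refine tsum_congr fun t => ?_
  by_cases ht : t ∈ (karyPMF κ (n + 1)).support
  · rw [step_sizeEvent hκ (isKaryTree_of_mem_support hκ n t ht), Finset.mul_sum]
    refine Finset.sum_congr rfl fun j _ => ?_
    rw [mul_left_comm]
    congr 1
    by_cases h1 : t ∈ sizeEvent (Function.update w j (w j - 1)) <;> simp [h1]
  · have h0 : karyPMF κ (n + 1) t = 0 := by
      rwa [PMF.mem_support_iff, not_not] at ht
    have hi : ∀ s : Set (Finset (List ℕ)), s.indicator (karyPMF κ (n + 1)) t = 0 := fun s => by
      by_cases hs : t ∈ s <;> simp [hs, h0]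
    simp only [h0, hi, zero_mul, mul_zero, Finset.sum_const_zero]

/-- The Dirichlet-multinomial mass function, with parameter `a` and total `m`. -/
noncomputable def dirichletMultinomial {κ : ℕ} (a : ℝ) (m : ℕ) (w : Fin κ → ℕ) : ℝ :=
  (Nat.multinomial Finset.univ w : ℝ) *
    (Real.Gamma ((κ : ℝ) * a) / (Real.Gamma a) ^ κ) *
    (∏ j, Real.Gamma ((w j : ℝ) + a)) / Real.Gamma ((m : ℝ) + (κ : ℝ) * a)

lemma dirichletMultinomial_nonneg {κ : ℕ} {a : ℝ} (ha : 0 < a) (m : ℕ) (w : Fin κ → ℕ) :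
    0 ≤ dirichletMultinomial a m w := by
  have h1 : 0 ≤ Real.Gamma a := (Real.Gamma_pos_of_pos ha).le
  have h2 : 0 ≤ Real.Gamma (κ * a) := Real.Gamma_nonneg_of_nonneg (by positivity)
  have h3 : 0 ≤ Real.Gamma (m + κ * a) := Real.Gamma_nonneg_of_nonneg (by positivity)
  have h4 : 0 ≤ ∏ j, Real.Gamma ((w j : ℝ) + a) :=
    Finset.prod_nonneg fun j _ => Real.Gamma_nonneg_of_nonneg (by positivity)
  unfold dirichletMultinomial
  positivity

lemma succ_mul_multinomial_update {κ m : ℕ} (w : Fin κ → ℕ) (hw : ∑ i, w i = m + 1)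
    (j : Fin κ) (hj : w j ≠ 0) :
    ((m : ℝ) + 1) * (Nat.multinomial Finset.univ (Function.update w j (w j - 1)) : ℝ) =
      Nat.multinomial Finset.univ w * w j := by
  set v := Function.update w j (w j - 1) with hv
  have hvj : v j + 1 = w j := by
    rw [hv, Function.update_self]; omega
  have hoff : ∀ i ∈ Finset.univ.erase j, v i = w i := fun i hi =>
    Function.update_of_ne (Finset.ne_of_mem_erase hi) _ _
  have hsum : ∑ i, v i = m := by
    have hv_sum := Finset.add_sum_erase _ (fun i => v i) (Finset.mem_univ j)
    have hw_sum := Finset.add_sum_erase _ (fun i => w i) (Finset.mem_univ j)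
    have hvw : ∑ i ∈ Finset.univ.erase j, v i = ∑ i ∈ Finset.univ.erase j, w i :=
      Finset.sum_congr rfl hoff
    omega
  have h1 := Nat.multinomial_spec Finset.univ v
  have h2 := Nat.multinomial_spec Finset.univ w
  rw [hsum] at h1
  rw [hw, Nat.factorial_succ, ← h1, ← Finset.mul_prod_erase _ _ (Finset.mem_univ j),
    ← Finset.mul_prod_erase _ (fun i => (v i).factorial) (Finset.mem_univ j),
    Finset.prod_congr rfl (fun i hi => by rw [hoff i hi] :
      ∀ i ∈ Finset.univ.erase j, (v i).factorial = (w i).factorial), ← hvj,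
    Nat.factorial_succ] at h2
  have hpos : (v j).factorial * ∏ i ∈ Finset.univ.erase j, (w i).factorial ≠ 0 :=
    mul_ne_zero (Nat.factorial_ne_zero _)
      (Finset.prod_ne_zero_iff.2 fun i _ => Nat.factorial_ne_zero _)
  have h3 : (m + 1) * Nat.multinomial Finset.univ v = Nat.multinomial Finset.univ w * w j := by
    apply mul_left_cancel₀ hpos
    rw [← hvj]
    linarith
  exact_mod_cast h3

lemma dirichletMultinomial_update {κ m : ℕ} {a : ℝ} (ha : 0 < a) (w : Fin κ → ℕ)
    (hw : ∑ i, w i = m + 1) (j : Fin κ) (hj : w j ≠ 0) :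
    (a + (w j - 1)) / (m + κ * a) *
        dirichletMultinomial a m (Function.update w j (w j - 1)) =
      dirichletMultinomial a (m + 1) w * (w j / (m + 1)) := by
  have hκ : 0 < κ := j.pos
  have hmult := succ_mul_multinomial_update w hw j hj
  set v := Function.update w j (w j - 1) with hv
  have hvj : v j + 1 = w j := by
    rw [hv, Function.update_self]; omega
  have hvj' : (w j : ℝ) = v j + 1 := by rw [← hvj]; push_cast; ring
  have hoff : ∀ i ∈ Finset.univ.erase j, Real.Gamma ((v i : ℝ) + a) = Real.Gamma (w i + a) :=
    fun i hi => by rw [hv, Function.update_of_ne (Finset.ne_of_mem_erase hi)]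
  have hden : (0 : ℝ) < m + κ * a := by positivity
  have hva : (0 : ℝ) < v j + a := by positivity
  have hG : Real.Gamma (((m + 1 : ℕ) : ℝ) + κ * a) =
      (m + κ * a) * Real.Gamma (m + κ * a) := by
    rw [← Real.Gamma_add_one hden.ne']
    push_cast
    ring_nf
  have hGj : Real.Gamma ((w j : ℝ) + a) = (v j + a) * Real.Gamma (v j + a) := by
    rw [← Real.Gamma_add_one hva.ne', hvj']
    ring_nf
  have hGpos := Real.Gamma_pos_of_pos hden
  have hGa := Real.Gamma_pos_of_pos ha
  unfold dirichletMultinomial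
  rw [hG, ← Finset.mul_prod_erase _ _ (Finset.mem_univ j),
    ← Finset.mul_prod_erase _ (fun i => Real.Gamma ((w i : ℝ) + a)) (Finset.mem_univ j),
    Finset.prod_congr rfl hoff, hGj]
  have hM : (Nat.multinomial Finset.univ v : ℝ) = Nat.multinomial Finset.univ w * w j / (m + 1) := by
    rw [← hmult]
    field_simp
  rw [hM, hvj']
  field_simp
  ring

lemma dirichletMultinomial_zero {κ : ℕ} (hκ : 0 < κ) {a : ℝ} (ha : 0 < a) :
    dirichletMultinomial a 0 (0 : Fin κ → ℕ) = 1 := by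
  have h1 := (Real.Gamma_pos_of_pos ha).ne'
  have h2 : Real.Gamma (κ * a) ≠ 0 := (Real.Gamma_pos_of_pos (by positivity)).ne'
  simp [dirichletMultinomial, Nat.multinomial]
  field_simp

lemma karyPMF_sizeEvent {κ : ℕ} (hκ : 2 ≤ κ) (m : ℕ) (w : Fin κ → ℕ) (hw : ∑ i, w i = m) :
    (karyPMF κ (m + 1)).toOuterMeasure (sizeEvent w) =
      ENNReal.ofReal (dirichletMultinomial (1 / ((κ : ℝ) - 1)) m w) := by
  have hκ0 : 0 < κ := by omega
  have hκ1 : (0 : ℝ) < κ - 1 := by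
    have : (2 : ℝ) ≤ κ := by exact_mod_cast hκ
    linarith
  have ha : 0 < 1 / ((κ : ℝ) - 1) := by positivity
  induction m generalizing w with
  | zero =>
    have hw0 : w = 0 := by
      funext i
      exact Finset.sum_eq_zero_iff.1 hw i (Finset.mem_univ i)
    subst hw0
    have hstar := isKaryTree_star hκ0
    have hmem : treeGrow κ {[]} [] ∈ sizeEvent (0 : Fin κ → ℕ) := fun j =>
      Finset.sum_eq_zero_iff.1 hstar.sum_subCount j (Finset.mem_range.2 j.2)
    rw [dirichletMultinomial_zero hκ0 ha, zero_add, karyPMF_one, PMF.toOuterMeasure_pure_apply,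
      if_pos hmem, ENNReal.ofReal_one]
  | succ m ih =>
    rw [karyPMF_succ_sizeEvent hκ0]
    have hterm : ∀ j : Fin κ, (if w j = 0 then 0 else
        ((1 + (κ - 1) * (w j - 1) : ℕ) : ℝ≥0∞) / ((κ + (κ - 1) * m : ℕ) : ℝ≥0∞)) *
        (karyPMF κ (m + 1)).toOuterMeasure (sizeEvent (Function.update w j (w j - 1))) =
        ENNReal.ofReal (dirichletMultinomial (1 / ((κ : ℝ) - 1)) (m + 1) w *
          (w j / (m + 1))) := by
      intro j
      split_ifs with hj
      · simp [hj]
      · have hsum : ∑ i, Function.update w j (w j - 1) i = m := by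
          rw [Finset.sum_update_of_mem (Finset.mem_univ j)]
          rw [← Finset.add_sum_erase _ _ (Finset.mem_univ j), Finset.erase_eq] at hw
          omega
        have hpos : (0 : ℝ) < ((κ + (κ - 1) * m : ℕ) : ℝ) := by
          exact_mod_cast (by omega : 0 < κ + (κ - 1) * m)
        rw [ih _ hsum, ← dirichletMultinomial_update ha w hw j hj, ← ENNReal.ofReal_natCast,
          ← ENNReal.ofReal_natCast, ← ENNReal.ofReal_div_of_pos hpos,
          ← ENNReal.ofReal_mul (by positivity)]
        congr 2
        have h1 : 1 ≤ κ := hκ0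
        have h2 : 1 ≤ w j := Nat.one_le_iff_ne_zero.2 hj
        have h3 : (κ : ℝ) + (κ - 1) * m ≠ 0 := by positivity
        push_cast [Nat.cast_sub h1, Nat.cast_sub h2]
        rw [div_eq_div_iff h3 (by positivity)]
        field_simp
        ring
    rw [Finset.sum_congr rfl fun j _ => hterm j, ← ENNReal.ofReal_sum_of_nonneg
      fun j _ => mul_nonneg (dirichletMultinomial_nonneg ha _ _) (by positivity),
      ← Finset.mul_sum, ← Finset.sum_div, ← Nat.cast_sum, hw]
    congr 1
    push_cast
    rw [div_self (by positivity), mul_one]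

/-- for the random recursive κ-ary tree with `n` internal nodes, the vector
of the numbers of internal nodes of the κ subtrees of the root follows the
Dirichlet-multinomial distribution with parameter `α = 1/(κ−1)`:
`P((N̄₁,…,N̄_κ) = (n₁,…,n_κ)) = (n−1 choose n₁,…,n_κ) (Γ(κα)/Γ(α)^κ) ∏ Γ(nᵢ+α) / Γ(n−1+κα)`. -/
theorem stmt_12 (κ n : ℕ) (hκ : 2 ≤ κ) (hn : 1 ≤ n)
    (nvec : Fin κ → ℕ) (hsum : ∑ j, nvec j = n - 1) :
    (∑' t : {t : Finset (List ℕ) // ∀ j : Fin κ, subCount t (j : ℕ) = nvec j},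
        karyPMF κ n t)
      = ENNReal.ofReal ((Nat.multinomial Finset.univ nvec : ℝ) *
          (Real.Gamma ((κ : ℝ) * (1 / ((κ : ℝ) - 1))) /
              (Real.Gamma (1 / ((κ : ℝ) - 1))) ^ κ) *
          (∏ j, Real.Gamma ((nvec j : ℝ) + 1 / ((κ : ℝ) - 1))) /
          Real.Gamma ((n : ℝ) - 1 + (κ : ℝ) * (1 / ((κ : ℝ) - 1)))) := by
  obtain ⟨m, rfl⟩ : ∃ m, n = m + 1 := ⟨n - 1, by omega⟩
  have h := karyPMF_sizeEvent hκ m nvec (by simpa using hsum)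
  rw [PMF.toOuterMeasure_apply] at h
  refine (tsum_subtype (sizeEvent nvec) (karyPMF κ (m + 1))).trans (h.trans ?_)
  simp only [dirichletMultinomial, Nat.cast_add, Nat.cast_one, add_sub_cancel_right]
end
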